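/- Let G have girth at least g and let u, v, w be vertices with d_G(w,u) < g/2 - 1, d_G(u,v) = 1, and d_G(w,v) < g/2. Then either d_G(w,u) = d_G(w,v) - 1 and u lies on the unique shortest path from w to v, or d_G(w,u) = d_G(w,v) + 1 and v lies on the unique shortest path from w to u. -/

import Mathlib

namespace SimpleGraph

variable {V : Type*} {G : SimpleGraph V} {u v : V}

/-- Two paths with the same endpoints and total length less than the girth coincide. -/
theorem Walk.IsPath.eq_of_length_add_lt_egirth {p q : G.Walk u v} (hp : p.IsPath)
    (hq : q.IsPath) (h : ((p.length + q.length : ℕ) : ℕ∞) < G.egirth) : p = q := by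
  by_contra hne
  obtain ⟨_, _, _, c, hc, hlen⟩ := hp.exists_isCycle_length_le_add_of_ne hq hne
  exact ((egirth_le_length hc).trans (by exact_mod_cast hlen)).not_gt h

end SimpleGraph

/-- If `G` has girth at least `g` and `u, v, w` satisfy `d(w,u) < g/2 - 1`, `d(u,v) = 1`
and `d(w,v) < g/2`, then either `d(w,u) = d(w,v) - 1` and `u` lies on the unique shortest
path from `w` to `v`, or `d(w,u) = d(w,v) + 1` and `v` lies on the unique shortest path
from `w` to `u`. (Lying on the unique shortest path is expressed as lying on every
shortest path, which is equivalent since shortest paths between vertices at distance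
`< g/2` are unique.) -/
theorem neighbor_on_shortest_path_cases {V : Type*} (G : SimpleGraph V) (g : ℕ)
    (hgirth : (g : ℕ∞) ≤ G.egirth) (hconn : G.Connected) (u v w : V)
    (hwu : 2 * G.dist w u + 2 < g) (huv : G.dist u v = 1) (hwv : 2 * G.dist w v < g) :
    (G.dist w u + 1 = G.dist w v ∧
      ∀ p : G.Walk w v, p.IsPath → p.length = G.dist w v → u ∈ p.support) ∨
    (G.dist w u = G.dist w v + 1 ∧
      ∀ p : G.Walk w u, p.IsPath → p.length = G.dist w u → v ∈ p.support) := by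
  have eq_of_lt {x : V} {p q : G.Walk w x} (hp : p.IsPath) (hq : q.IsPath)
      (h : p.length + q.length < g) : p = q :=
    hp.eq_of_length_add_lt_egirth hq ((Nat.cast_lt.mpr h).trans_le hgirth)
  have hadj : G.Adj u v := SimpleGraph.dist_eq_one_iff_adj.mp huv
  obtain ⟨q, hq, hql⟩ := hconn.exists_path_of_dist w v
  by_cases hu : u ∈ q.support
  · left
    refine ⟨le_antisymm ?_ ?_, fun p hp hpl => eq_of_lt hp hq (by omega) ▸ hu⟩
    · obtain ⟨a, b, hab⟩ := SimpleGraph.Walk.mem_support_iff_exists_append.mp hu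
      have ha := SimpleGraph.dist_le a
      have hb := SimpleGraph.dist_le b
      have hlen := congrArg SimpleGraph.Walk.length hab
      rw [SimpleGraph.Walk.length_append] at hlen
      omega
    · exact huv ▸ hconn.dist_triangle
  · right
    have hqu : (q.concat hadj.symm).IsPath := hq.concat hu hadj.symm
    have eq_concat (p : G.Walk w u) (hp : p.IsPath) (hpl : p.length = G.dist w u) :
        p = q.concat hadj.symm := by
      refine eq_of_lt hp hqu ?_
      have htri : G.dist w v ≤ G.dist w u + G.dist u v := hconn.dist_triangle
      rw [SimpleGraph.Walk.length_concat]
      omega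
    constructor
    · obtain ⟨p, hp, hpl⟩ := hconn.exists_path_of_dist w u
      rw [← hpl, eq_concat p hp hpl, SimpleGraph.Walk.length_concat, hql]
    · intro p hp hpl
      rw [eq_concat p hp hpl]
      exact q.support_subset_support_concat hadj.symm q.end_mem_support
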